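/- Let f ∈ L_n^d be a Lorentzian polynomial. Then for every x ∈ ℝ^n with nonnegative coordinates and all multi-indices α, β, γ ∈ ℕ^n satisfying α = β + γ and |α| ≤ d, one has f(x)·∂^α f(x) ≤ 2^{|β||γ|} · ((d−|β|)!·(d−|γ|)!)/(d!·(d−|α|)!) · ∂^β f(x)·∂^γ f(x). -/

import Mathlib

open MvPolynomial

namespace LorentzianPaper

/-- Iterated partial derivative `∂^α f`. -/
noncomputable def pd {n : ℕ} (α : Fin n → ℕ) (f : MvPolynomial (Fin n) ℝ) :
    MvPolynomial (Fin n) ℝ :=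
  (List.finRange n).foldr (fun i g => (fun h => pderiv i h)^[α i] g) f

/-- Hessian matrix of `f` at `x`. -/
noncomputable def hess {n : ℕ} (f : MvPolynomial (Fin n) ℝ) (x : Fin n → ℝ) :
    Matrix (Fin n) (Fin n) ℝ :=
  Matrix.of fun i j => eval x (pderiv i (pderiv j f))

/-- Number of positive eigenvalues (with multiplicity) of a real symmetric matrix. -/
noncomputable def posEigCount {n : ℕ} (M : Matrix (Fin n) (Fin n) ℝ) : ℕ :=
  if h : M.IsHermitian then {i | 0 < h.eigenvalues i}.ncard else 0

/-- Homogeneous polynomials of degree `d` with all coefficients positive. -/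
def PPos (n d : ℕ) : Set (MvPolynomial (Fin n) ℝ) :=
  {f | f.IsHomogeneous d ∧ ∀ α : Fin n →₀ ℕ, (∑ i, α i) = d → 0 < f.coeff α}

/-- Strictly Lorentzian quadratics. -/
def StrictLor2 (n : ℕ) : Set (MvPolynomial (Fin n) ℝ) :=
  {f | f ∈ PPos n 2 ∧ IsUnit (hess f 0).det ∧ posEigCount (hess f 0) = 1}

/-- Strictly Lorentzian polynomials. -/
def StrictLor (n d : ℕ) : Set (MvPolynomial (Fin n) ℝ) :=
  if d ≤ 1 then PPos n d
  else {f | f ∈ PPos n d ∧ ∀ α : Fin n → ℕ, (∑ i, α i) = d - 2 → pd α f ∈ StrictLor2 n}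

noncomputable def coeffFun {n : ℕ} (f : MvPolynomial (Fin n) ℝ) : (Fin n →₀ ℕ) → ℝ :=
  fun α => f.coeff α

/-- Lorentzian polynomials: closure of the strictly Lorentzian ones in `H_n^d`. -/
def Lor (n d : ℕ) : Set (MvPolynomial (Fin n) ℝ) :=
  {f | f.IsHomogeneous d ∧ coeffFun f ∈ closure (coeffFun '' StrictLor n d)}

/-- `c`-Rayleigh polynomials. -/
def IsRayleigh {n : ℕ} (c : ℝ) (f : MvPolynomial (Fin n) ℝ) : Prop :=
  (∀ α, 0 ≤ f.coeff α) ∧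
  ∀ (α : Fin n → ℕ) (i j : Fin n) (x : Fin n → ℝ), (∀ t, 0 ≤ x t) →
    eval x (pd α f) * eval x (pd (α + Pi.single i 1 + Pi.single j 1) f) ≤
      c * eval x (pd (α + Pi.single i 1) f) * eval x (pd (α + Pi.single j 1) f)

open Matrix in
/-- Spectral decomposition in coordinates. -/
lemma spectral_aux {n : ℕ} {A : Matrix (Fin n) (Fin n) ℝ} (h : A.IsHermitian) :
    ∃ u : Fin n → Fin n → ℝ, (∀ k, A *ᵥ u k = h.eigenvalues k • u k) ∧ (∀ k, u k ⬝ᵥ u k = 1) ∧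
      ∀ v w : Fin n → ℝ, ∑ k, (u k ⬝ᵥ v) * (u k ⬝ᵥ w) = v ⬝ᵥ w := by
  refine ⟨fun k => ⇑(h.eigenvectorBasis k), fun k => h.mulVec_eigenvectorBasis k, fun k => ?_, ?_⟩
  · have := h.eigenvectorBasis.orthonormal.1 k
    have h2 : inner ℝ (h.eigenvectorBasis k) (h.eigenvectorBasis k) = (1 : ℝ) := by
      rw [real_inner_self_eq_norm_sq, this]; norm_num
    rw [EuclideanSpace.inner_eq_star_dotProduct, star_trivial] at h2
    exact h2
  · intro v w
    have := h.eigenvectorBasis.sum_inner_mul_inner (WithLp.toLp 2 v) (WithLp.toLp 2 w)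
    simp only [EuclideanSpace.inner_eq_star_dotProduct, star_trivial] at this
    rw [dotProduct_comm v w, ← this]
    refine Finset.sum_congr rfl fun k _ => ?_
    rw [dotProduct_comm w]

open Matrix in
lemma symm_dot {n : ℕ} {A : Matrix (Fin n) (Fin n) ℝ} (h : A.IsHermitian) (v w : Fin n → ℝ) :
    v ⬝ᵥ A *ᵥ w = w ⬝ᵥ A *ᵥ v := by
  have hT : Aᵀ = A := by
    ext i j; simpa using h.apply i j
  rw [dotProduct_comm w, dotProduct_mulVec, ← mulVec_transpose, hT]

open Matrix in
lemma spectral_quad {n : ℕ} {A : Matrix (Fin n) (Fin n) ℝ} (h : A.IsHermitian)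
    (u : Fin n → Fin n → ℝ) (hu : ∀ k, A *ᵥ u k = h.eigenvalues k • u k)
    (hp : ∀ v w : Fin n → ℝ, ∑ k, (u k ⬝ᵥ v) * (u k ⬝ᵥ w) = v ⬝ᵥ w) (v : Fin n → ℝ) :
    v ⬝ᵥ A *ᵥ v = ∑ k, h.eigenvalues k * (u k ⬝ᵥ v) ^ 2 := by
  rw [← hp]
  refine Finset.sum_congr rfl fun k _ => ?_
  rw [symm_dot h (u k) v, hu, dotProduct_smul, dotProduct_comm v, smul_eq_mul]; ring

open Matrix in
/-- Hyperbolicity of `A` with respect to `x`. -/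
def Hyp {n : ℕ} (A : Matrix (Fin n) (Fin n) ℝ) (x : Fin n → ℝ) : Prop :=
  ∀ z, (z ⬝ᵥ A *ᵥ z) * (x ⬝ᵥ A *ᵥ x) ≤ (z ⬝ᵥ A *ᵥ x) ^ 2

open Matrix in
lemma hyp_of_orth {n : ℕ} {A : Matrix (Fin n) (Fin n) ℝ} (h : A.IsHermitian) (x : Fin n → ℝ)
    (hx : 0 < x ⬝ᵥ A *ᵥ x) (ho : ∀ w, w ⬝ᵥ A *ᵥ x = 0 → w ⬝ᵥ A *ᵥ w ≤ 0) : Hyp A x := by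
  intro z
  have h0 : (z - ((z ⬝ᵥ A *ᵥ x) / (x ⬝ᵥ A *ᵥ x)) • x) ⬝ᵥ A *ᵥ x = 0 := by
    rw [sub_dotProduct, smul_dotProduct, smul_eq_mul]; field_simp; ring
  have h1 := ho _ h0
  rw [mulVec_sub, dotProduct_sub, mulVec_smul, dotProduct_smul, h0, sub_dotProduct,
    smul_dotProduct, symm_dot h x z] at h1
  simp only [smul_eq_mul, mul_zero, sub_zero] at h1
  have h2 := mul_nonpos_of_nonpos_of_nonneg h1 hx.le
  have h3 : (z ⬝ᵥ A *ᵥ z - (z ⬝ᵥ A *ᵥ x) / (x ⬝ᵥ A *ᵥ x) * (z ⬝ᵥ A *ᵥ x)) * (x ⬝ᵥ A *ᵥ x)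
    = (z ⬝ᵥ A *ᵥ z) * (x ⬝ᵥ A *ᵥ x) - (z ⬝ᵥ A *ᵥ x) ^ 2 := by field_simp
  linarith

open Matrix in
lemma dot_pos {n : ℕ} (hn : 0 < n) {v w : Fin n → ℝ} (hv : ∀ i, 0 < v i) (hw : ∀ i, 0 < w i) :
    0 < v ⬝ᵥ w := by
  have : Nonempty (Fin n) := ⟨⟨0, hn⟩⟩
  exact Finset.sum_pos (fun i _ => mul_pos (hv i) (hw i)) Finset.univ_nonempty

open Matrix in
lemma mulVec_pos' {n : ℕ} (hn : 0 < n) {A : Matrix (Fin n) (Fin n) ℝ} {x : Fin n → ℝ}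
    (hA : ∀ i j, 0 < A i j) (hx : ∀ i, 0 < x i) (i : Fin n) : 0 < (A *ᵥ x) i :=
  dot_pos hn (hA i) hx

open Matrix in
/-- Base case. -/
lemma hyp_base {n : ℕ} (hn : 0 < n) {A : Matrix (Fin n) (Fin n) ℝ} (h : A.IsHermitian)
    (hA : ∀ i j, 0 < A i j) (hc : posEigCount A = 1) (x : Fin n → ℝ) (hx : ∀ i, 0 < x i) :
    Hyp A x := by
  have hxx : 0 < x ⬝ᵥ A *ᵥ x := dot_pos hn hx (mulVec_pos' hn hA hx)
  refine hyp_of_orth h x hxx fun w hw => ?_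
  by_contra hneg
  push Not at hneg
  obtain ⟨u, hu, -, hp⟩ := spectral_aux h
  rw [posEigCount, dif_pos h, Set.ncard_eq_one] at hc
  obtain ⟨k0, hk0⟩ := hc
  have hle : ∀ k, k ≠ k0 → h.eigenvalues k ≤ 0 := by
    intro k hk
    by_contra hlt
    push Not at hlt
    have : k ∈ ({k0} : Set (Fin n)) := hk0 ▸ hlt
    exact hk this
  have key : ∀ v : Fin n → ℝ, u k0 ⬝ᵥ v = 0 → v ⬝ᵥ A *ᵥ v ≤ 0 := by
    intro v hv
    rw [spectral_quad h u hu hp]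
    refine Finset.sum_nonpos fun k _ => ?_
    by_cases hk : k = k0
    · subst hk; rw [hv]; simp
    · exact mul_nonpos_of_nonpos_of_nonneg (hle k hk) (sq_nonneg _)
  have hxne : u k0 ⬝ᵥ x ≠ 0 := fun h0 => absurd (key x h0) (not_le.2 hxx)
  set a := u k0 ⬝ᵥ x
  set b := u k0 ⬝ᵥ w
  have h1 := key (a • w - b • x) (by
    rw [dotProduct_sub, dotProduct_smul, dotProduct_smul]; simp only [smul_eq_mul]; ring)
  have hw' : x ⬝ᵥ A *ᵥ w = 0 := by rw [symm_dot h, hw]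
  simp only [mulVec_sub, mulVec_smul, dotProduct_sub, dotProduct_smul, sub_dotProduct,
    smul_dotProduct, smul_eq_mul, hw, hw'] at h1
  have : 0 < a ^ 2 := by positivity
  nlinarith [mul_pos this hneg, mul_nonneg (sq_nonneg b) hxx.le]

open Matrix in
/-- Inductive step (Bochner-type argument). -/
lemma hyp_step {n : ℕ} (hn : 0 < n) {A : Matrix (Fin n) (Fin n) ℝ} (h : A.IsHermitian)
    (hA : ∀ i j, 0 < A i j) (x : Fin n → ℝ) (hx : ∀ i, 0 < x i)
    (B : Fin n → Matrix (Fin n) (Fin n) ℝ) (c : ℝ) (hc : 0 < c)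
    (hB : ∀ i, Hyp (B i) x) (hBx : ∀ i, B i *ᵥ x = c • A i)
    (hBA : ∀ z : Fin n → ℝ, ∑ i, x i * (z ⬝ᵥ B i *ᵥ z) = c * (z ⬝ᵥ A *ᵥ z)) : Hyp A x := by
  have hAx := mulVec_pos' hn hA hx
  have hxx : 0 < x ⬝ᵥ A *ᵥ x := dot_pos hn hx hAx
  have hsym : ∀ i j, A i j = A j i := fun i j => by simpa using (h.apply i j).symm
  refine hyp_of_orth h x hxx fun w hw => ?_
  -- the main inequality
  have main : ∀ z : Fin n → ℝ, z ⬝ᵥ A *ᵥ z ≤ ∑ i, x i / (A *ᵥ x) i * ((A *ᵥ z) i) ^ 2 := by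
    intro z
    have h1 : ∀ i, x i * (z ⬝ᵥ B i *ᵥ z) ≤ c * (x i / (A *ᵥ x) i * ((A *ᵥ z) i) ^ 2) := by
      intro i
      have := hB i z
      rw [hBx i, dotProduct_smul, dotProduct_smul, smul_eq_mul, smul_eq_mul,
        dotProduct_comm x, dotProduct_comm z (A i)] at this
      change _ * (c * (A *ᵥ x) i) ≤ (c * (A *ᵥ z) i) ^ 2 at this
      have h2 : (z ⬝ᵥ B i *ᵥ z) ≤ c * ((A *ᵥ z) i) ^ 2 / (A *ᵥ x) i := by
        rw [le_div_iff₀ (hAx i)]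
        refine le_of_mul_le_mul_left ?_ hc
        nlinarith
      calc x i * (z ⬝ᵥ B i *ᵥ z) ≤ x i * (c * ((A *ᵥ z) i) ^ 2 / (A *ᵥ x) i) :=
            mul_le_mul_of_nonneg_left h2 (hx i).le
        _ = _ := by ring
    have h3 := Finset.sum_le_sum fun i (_ : i ∈ Finset.univ) => h1 i
    rw [hBA, ← Finset.mul_sum] at h3
    exact le_of_mul_le_mul_left h3 hc
  set r : Fin n → ℝ := fun i => Real.sqrt (x i / (A *ᵥ x) i) with hr
  have hrpos : ∀ i, 0 < r i := fun i => Real.sqrt_pos.2 (div_pos (hx i) (hAx i))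
  have hr2 : ∀ i, r i ^ 2 = x i / (A *ᵥ x) i := fun i => Real.sq_sqrt (div_pos (hx i) (hAx i)).le
  set M : Matrix (Fin n) (Fin n) ℝ := Matrix.of fun i j => r i * A i j * r j with hM
  have hMh : M.IsHermitian := by
    ext i j
    simp [hM, hsym i j]; ring
  have hMv : ∀ v i, (M *ᵥ v) i = r i * (A *ᵥ (r * v)) i := by
    intro v i
    simp only [mulVec, dotProduct, hM, Matrix.of_apply, Finset.mul_sum, Pi.mul_apply]
    exact Finset.sum_congr rfl fun j _ => by ring
  have hMq : ∀ v, v ⬝ᵥ M *ᵥ v = (r * v) ⬝ᵥ A *ᵥ (r * v) := by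
    intro v
    simp only [dotProduct, hMv, Pi.mul_apply]
    exact Finset.sum_congr rfl fun j _ => by ring
  obtain ⟨u, hu, hu1, hp⟩ := spectral_aux hMh
  have hquad : ∀ k, (r * u k) ⬝ᵥ A *ᵥ (r * u k) = hMh.eigenvalues k := by
    intro k
    rw [← hMq, hu, dotProduct_smul, hu1, smul_eq_mul, mul_one]
  have hle2 : ∀ k, hMh.eigenvalues k ≤ hMh.eigenvalues k ^ 2 := by
    intro k
    have h1 := main (r * u k)
    rw [hquad] at h1
    refine h1.trans (le_of_eq ?_)
    have h2 : ∀ i, x i / (A *ᵥ x) i * ((A *ᵥ (r * u k)) i) ^ 2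
        = hMh.eigenvalues k ^ 2 * (u k i * u k i) := by
      intro i
      have h3 := congrFun (hu k) i
      rw [hMv, Pi.smul_apply, smul_eq_mul] at h3
      rw [← hr2, ← mul_pow, h3]; ring
    rw [Finset.sum_congr rfl fun i _ => h2 i, ← Finset.mul_sum]
    have := hu1 k
    rw [dotProduct] at this
    rw [this, mul_one]
  have hPF : ∀ z : Fin n → ℝ, ∑ i, ∑ j, A i j * x i * x j * (z i / x i - z j / x j) ^ 2
      = 2 * (∑ i, (A *ᵥ x) i / x i * z i ^ 2 - z ⬝ᵥ A *ᵥ z) := by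
    intro z
    have e : ∀ i j, A i j * x i * x j * (z i / x i - z j / x j) ^ 2
        = A i j * x j * (z i ^ 2 / x i) + A j i * x i * (z j ^ 2 / x j)
          - 2 * (z i * (A i j * z j)) := by
      intro i j
      rw [hsym j i]
      have := (hx i).ne'
      have := (hx j).ne'
      field_simp
      ring
    have e1 : ∑ i, ∑ j, A i j * x j * (z i ^ 2 / x i) = ∑ i, (A *ᵥ x) i / x i * z i ^ 2 := by
      refine Finset.sum_congr rfl fun i _ => ?_
      rw [← Finset.sum_mul]
      simp only [mulVec, dotProduct]; ring
    have e2 : ∑ i, ∑ j, A j i * x i * (z j ^ 2 / x j) = ∑ i, (A *ᵥ x) i / x i * z i ^ 2 := by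
      rw [Finset.sum_comm, e1]
    have e3 : ∑ i, ∑ j, 2 * (z i * (A i j * z j)) = 2 * (z ⬝ᵥ A *ᵥ z) := by
      simp only [mulVec, dotProduct, Finset.mul_sum]
    simp only [e, Finset.sum_sub_distrib, Finset.sum_add_distrib]
    rw [e1, e2, e3]; ring
  have hPFu : ∀ k, ∑ i, ∑ j, A i j * x i * x j * ((r * u k) i / x i - (r * u k) j / x j) ^ 2
      = 2 * (1 - hMh.eigenvalues k) := by
    intro k
    rw [hPF, hquad]
    congr 2
    rw [← hu1 k, dotProduct]
    refine Finset.sum_congr rfl fun i _ => ?_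
    rw [Pi.mul_apply, mul_pow, hr2]
    have := (hx i).ne'
    have := (hAx i).ne'
    field_simp
  have hterm : ∀ k i j, 0 ≤ A i j * x i * x j * ((r * u k) i / x i - (r * u k) j / x j) ^ 2 :=
    fun k i j => mul_nonneg (mul_pos (mul_pos (hA i j) (hx i)) (hx j)).le (sq_nonneg _)
  have horth : ∀ k, 0 < hMh.eigenvalues k → u k ⬝ᵥ (w / r) = 0 := by
    intro k hk
    have h0 := hPFu k
    have h1 : hMh.eigenvalues k = 1 := by
      have h2 : 0 ≤ 2 * (1 - hMh.eigenvalues k) := by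
        rw [← h0]; exact Finset.sum_nonneg fun i _ => Finset.sum_nonneg fun j _ => hterm k i j
      nlinarith [hle2 k]
    rw [h1, sub_self, mul_zero, Finset.sum_eq_zero_iff_of_nonneg
      (fun i _ => Finset.sum_nonneg fun j _ => hterm k i j)] at h0
    let o : Fin n := ⟨0, hn⟩
    have h2 : ∀ i, (r * u k) i = (r * u k) o / x o * x i := by
      intro i
      have h3 := h0 i (Finset.mem_univ _)
      rw [Finset.sum_eq_zero_iff_of_nonneg (fun j _ => hterm k i j)] at h3
      have h4 := h3 o (Finset.mem_univ _)
      have h5 : (r * u k) i / x i - (r * u k) o / x o = 0 := by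
        have := mul_pos (mul_pos (hA i o) (hx i)) (hx o)
        rcases mul_eq_zero.1 h4 with h6 | h6
        · exact absurd h6 this.ne'
        · exact pow_eq_zero_iff (two_ne_zero) |>.1 h6
      rw [← sub_eq_zero.1 h5, div_mul_cancel₀ _ (hx i).ne']
    have h3 : u k ⬝ᵥ (w / r) = (r * u k) o / x o * (w ⬝ᵥ A *ᵥ x) := by
      simp only [dotProduct, Finset.mul_sum, Pi.div_apply]
      refine Finset.sum_congr rfl fun i _ => ?_
      have h4 : u k i = ((r * u k) o / x o * x i) / r i := by
        rw [← h2 i, Pi.mul_apply, mul_div_cancel_left₀ _ (hrpos i).ne']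
      rw [h4]
      have h5 : x i = r i ^ 2 * (A *ᵥ x) i := by rw [hr2, div_mul_cancel₀ _ (hAx i).ne']
      have h6 := (hrpos i).ne'
      generalize (r * u k) o / x o = q
      calc q * x i / r i * (w i / r i) = q * (x i / r i ^ 2) * w i := by field_simp
        _ = q * (w i * (A *ᵥ x) i) := by
          rw [h5]; rw [mul_div_cancel_left₀ _ (pow_ne_zero 2 h6)]
          ring
    rw [h3, hw, mul_zero]
  have hwr : r * (w / r) = w := by
    ext i; simp only [Pi.mul_apply, Pi.div_apply]; exact mul_div_cancel₀ _ (hrpos i).ne'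
  rw [← hwr, ← hMq, spectral_quad hMh u hu hp]
  refine Finset.sum_nonpos fun k _ => ?_
  by_cases hk : 0 < hMh.eigenvalues k
  · rw [horth k hk]; simp
  · exact mul_nonpos_of_nonpos_of_nonneg (not_lt.1 hk) (sq_nonneg _)

open Matrix in
/-- Consequence of hyperbolicity. -/
lemma hyp_entry {n : ℕ} (hn : 0 < n) {A : Matrix (Fin n) (Fin n) ℝ} (h : A.IsHermitian)
    (hA : ∀ i j, 0 < A i j) (x : Fin n → ℝ) (hx : ∀ i, 0 < x i) (hH : Hyp A x) (i j : Fin n) :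
    A i j * (x ⬝ᵥ A *ᵥ x) ≤ 2 * (A *ᵥ x) i * (A *ᵥ x) j := by
  have hi := mulVec_pos' hn hA hx i
  have hj := mulVec_pos' hn hA hx j
  have hxx : 0 < x ⬝ᵥ A *ᵥ x := dot_pos hn hx (mulVec_pos' hn hA hx)
  have hs : A j i = A i j := by simpa using h.apply i j
  have h1 := hH ((A *ᵥ x) j • Pi.single i 1 + (A *ᵥ x) i • Pi.single j 1)
  simp only [mulVec_add, mulVec_smul, dotProduct_add, dotProduct_smul, add_dotProduct,
    smul_dotProduct, smul_eq_mul, single_one_dotProduct, mulVec_single_one, col_apply, hs] at h1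
  set p := (A *ᵥ x) i
  set q := (A *ᵥ x) j
  set t := x ⬝ᵥ A *ᵥ x
  have h2 : 0 ≤ q ^ 2 * A i i * t := mul_nonneg (mul_nonneg (sq_nonneg _) (hA i i).le) hxx.le
  have h3 : 0 ≤ p ^ 2 * A j j * t := mul_nonneg (mul_nonneg (sq_nonneg _) (hA j j).le) hxx.le
  have h4 : 0 < 2 * (p * q) := by positivity
  refine le_of_mul_le_mul_left ?_ h4
  nlinarith

lemma pderiv_comm' {n : ℕ} (i j : Fin n) (f : MvPolynomial (Fin n) ℝ) :
    pderiv i (pderiv j f) = pderiv j (pderiv i f) := by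
  ext m
  simp only [coeff_pderiv]
  by_cases h : i = j
  · subst h; rfl
  · rw [add_right_comm m]
    simp [h, Ne.symm h]
    ring

lemma foldr_comm {n : ℕ} (l : List (Fin n)) (α : Fin n → ℕ) (i : Fin n)
    (f : MvPolynomial (Fin n) ℝ) :
    l.foldr (fun i g => (fun h => pderiv i h)^[α i] g) (pderiv i f)
      = pderiv i (l.foldr (fun i g => (fun h => pderiv i h)^[α i] g) f) := by
  induction l with
  | nil => rfl
  | cons a l ih =>
    simp only [List.foldr_cons, ih]
    have hc : Function.Commute (fun h : MvPolynomial (Fin n) ℝ => pderiv a h)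
      (fun h => pderiv i h) := fun g => pderiv_comm' a i g
    exact (hc.iterate_left (α a)) _

lemma pd_pderiv {n : ℕ} (α : Fin n → ℕ) (i : Fin n) (f : MvPolynomial (Fin n) ℝ) :
    pd α (pderiv i f) = pderiv i (pd α f) := foldr_comm _ α i f

lemma foldr_add {n : ℕ} (l : List (Fin n)) (hl : l.Nodup) (α : Fin n → ℕ) (i : Fin n)
    (f : MvPolynomial (Fin n) ℝ) :
    l.foldr (fun k g => (fun h => pderiv k h)^[(α + Pi.single i 1 : Fin n → ℕ) k] g) f
      = if i ∈ l then pderiv i (l.foldr (fun k g => (fun h => pderiv k h)^[α k] g) f)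
        else l.foldr (fun k g => (fun h => pderiv k h)^[α k] g) f := by
  induction l with
  | nil => simp
  | cons a l ih =>
    rw [List.nodup_cons] at hl
    simp only [List.foldr_cons, ih hl.2, List.mem_cons]
    by_cases hia : i = a
    · subst hia
      simp only [hl.1, if_false, true_or, if_true, Pi.add_apply, Pi.single_eq_same]
      rw [Function.iterate_succ_apply']
    · have hs : (α + Pi.single i 1 : Fin n → ℕ) a = α a := by
        simp [Ne.symm hia]
      rw [hs]
      simp only [hia, false_or]
      split_ifs with hil
      · have hc : Function.Commute (fun h : MvPolynomial (Fin n) ℝ => pderiv a h)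
          (fun h => pderiv i h) := fun g => pderiv_comm' a i g
        exact (hc.iterate_left (α a)) _
      · rfl

lemma pd_add_single {n : ℕ} (α : Fin n → ℕ) (i : Fin n) (f : MvPolynomial (Fin n) ℝ) :
    pd (α + Pi.single i 1) f = pderiv i (pd α f) := by
  rw [pd, foldr_add _ (List.nodup_finRange n), if_pos (List.mem_finRange i)]; rfl

lemma pd_zero {n : ℕ} (f : MvPolynomial (Fin n) ℝ) : pd 0 f = f := by
  have : ∀ l : List (Fin n),
      l.foldr (fun i g => (fun h => pderiv i h)^[(0 : Fin n → ℕ) i] g) f = f := by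
    intro l
    induction l with
    | nil => rfl
    | cons a l ih => simp only [List.foldr_cons, ih]; rfl
  exact this _

lemma multi_induction {n : ℕ} {P : (Fin n → ℕ) → Prop} (h0 : P 0)
    (hs : ∀ α i, P α → P (α + Pi.single i 1)) (α : Fin n → ℕ) : P α := by
  obtain ⟨m, hm⟩ : ∃ m, ∑ i, α i = m := ⟨_, rfl⟩
  induction m generalizing α with
  | zero =>
    have : α = 0 := by
      ext i
      exact (Finset.sum_eq_zero_iff.1 hm) i (Finset.mem_univ _)
    rwa [this]
  | succ m ih =>
    have : ∃ i, α i ≠ 0 := by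
      by_contra hcon
      push Not at hcon
      simp [hcon] at hm
    obtain ⟨i, hi⟩ := this
    have he : α = (α - Pi.single i 1) + Pi.single i 1 := by
      ext j
      by_cases hj : j = i
      · subst hj; simp; omega
      · simp [hj]
    rw [he]
    apply hs
    apply ih
    rw [he] at hm
    simp only [Pi.add_apply, Finset.sum_add_distrib, Finset.sum_pi_single', Finset.mem_univ,
      if_true] at hm
    omega

lemma sum_add_single {n : ℕ} (α : Fin n → ℕ) (i : Fin n) :
    ∑ k, (α + Pi.single i 1 : Fin n → ℕ) k = ∑ k, α k + 1 := by
  simp [Finset.sum_add_distrib]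

lemma PPos_pderiv {n d : ℕ} {f : MvPolynomial (Fin n) ℝ} (hf : f ∈ PPos n (d + 1)) (i : Fin n) :
    pderiv i f ∈ PPos n d := by
  refine ⟨hf.1.pderiv, fun α hα => ?_⟩
  rw [coeff_pderiv]
  refine mul_pos (hf.2 _ ?_) (by positivity)
  simp [Finset.sum_add_distrib, hα, Finsupp.single_apply]

lemma StrictLor_PPos {n d : ℕ} {f : MvPolynomial (Fin n) ℝ} (hf : f ∈ StrictLor n d) :
    f ∈ PPos n d := by
  unfold StrictLor at hf
  split_ifs at hf
  · exact hf
  · exact hf.1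

lemma StrictLor_pderiv {n d : ℕ} {f : MvPolynomial (Fin n) ℝ} (hf : f ∈ StrictLor n (d + 1))
    (i : Fin n) : pderiv i f ∈ StrictLor n d := by
  have h1 := PPos_pderiv (StrictLor_PPos hf) i
  unfold StrictLor at hf ⊢
  split_ifs with hd
  · exact h1
  · rw [if_neg (by omega)] at hf
    refine ⟨h1, fun α hα => ?_⟩
    rw [pd_pderiv, ← pd_add_single]
    apply hf.2
    rw [sum_add_single, hα]; omega

lemma StrictLor_pd {n d : ℕ} {f : MvPolynomial (Fin n) ℝ} (hf : f ∈ StrictLor n d)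
    (α : Fin n → ℕ) (hα : ∑ i, α i ≤ d) : pd α f ∈ StrictLor n (d - ∑ i, α i) := by
  induction α using multi_induction with
  | h0 => rw [pd_zero]; simpa using hf
  | hs α i ih =>
    rw [sum_add_single] at hα ⊢
    rw [pd_add_single]
    apply StrictLor_pderiv
    have := ih (by omega)
    rwa [show d - (∑ i, α i + 1) + 1 = d - ∑ i, α i by omega]

lemma PPos_eval_pos {n d : ℕ} (hn : 0 < n) {f : MvPolynomial (Fin n) ℝ} (hf : f ∈ PPos n d)
    (x : Fin n → ℝ) (hx : ∀ i, 0 < x i) : 0 < eval x f := by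
  rw [eval_eq']
  refine Finset.sum_pos (fun s hs => mul_pos ?_ (Finset.prod_pos fun i _ => pow_pos (hx i) _)) ?_
  · apply hf.2
    have := hf.1 (mem_support_iff.1 hs)
    rw [← this, Finsupp.weight_apply, Finsupp.sum_fintype]
    · simp
    · simp
  · refine ⟨Finsupp.single ⟨0, hn⟩ d, ?_⟩
    rw [mem_support_iff]
    refine (hf.2 _ ?_).ne'
    simp [Finsupp.single_apply]

lemma hess_herm {n : ℕ} (f : MvPolynomial (Fin n) ℝ) (x : Fin n → ℝ) :
    (hess f x).IsHermitian := by
  ext i j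
  simp only [hess, Matrix.conjTranspose_apply, Matrix.of_apply, star_trivial]
  rw [pderiv_comm']

lemma hess_pos {n d : ℕ} (hn : 0 < n) {f : MvPolynomial (Fin n) ℝ} (hf : f ∈ PPos n (d + 2))
    (x : Fin n → ℝ) (hx : ∀ i, 0 < x i) (i j : Fin n) : 0 < hess f x i j :=
  PPos_eval_pos hn (PPos_pderiv (PPos_pderiv hf j) i) x hx

lemma euler_eval {n d : ℕ} {f : MvPolynomial (Fin n) ℝ} (hf : f.IsHomogeneous d)
    (x : Fin n → ℝ) : ∑ i, x i * eval x (pderiv i f) = d * eval x f := by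
  have := congrArg (eval x) hf.sum_X_mul_pderiv
  simpa using this

open Matrix in
lemma hess_mulVec {n d : ℕ} {f : MvPolynomial (Fin n) ℝ} (hf : f.IsHomogeneous (d + 1))
    (x : Fin n → ℝ) (i : Fin n) : (hess f x *ᵥ x) i = d * eval x (pderiv i f) := by
  rw [← euler_eval (d := d) (f := pderiv i f) hf.pderiv x]
  simp only [hess, mulVec, dotProduct, Matrix.of_apply]
  refine Finset.sum_congr rfl fun j _ => ?_
  rw [pderiv_comm' i j, mul_comm]

lemma hess_hyp {n : ℕ} (hn : 0 < n) (x : Fin n → ℝ) (hx : ∀ i, 0 < x i) (d : ℕ)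
    (f : MvPolynomial (Fin n) ℝ) (hf : f ∈ StrictLor n (d + 2)) : Hyp (hess f x) x := by
  induction d generalizing f with
  | zero =>
    have hP := StrictLor_PPos hf
    simp only [StrictLor] at hf
    rw [if_neg (by omega)] at hf
    have h2 := hf.2 0 (by simp)
    rw [pd_zero] at h2
    have he : hess f x = hess f 0 := by
      ext i j
      simp only [hess, Matrix.of_apply]
      have h3 : (pderiv i (pderiv j f)).IsHomogeneous 0 := hP.1.pderiv.pderiv
      rw [← totalDegree_zero_iff_isHomogeneous, totalDegree_eq_zero_iff_eq_C] at h3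
      rw [h3]; simp
    refine hyp_base hn (hess_herm f x) (hess_pos hn hP x hx) ?_ x hx
    rw [he]; exact h2.2.2
  | succ d ih =>
    have hP := StrictLor_PPos hf
    refine hyp_step hn (hess_herm f x) (hess_pos (d := d + 1) hn hP x hx) x hx
      (fun i => hess (pderiv i f) x) (d + 1) (by positivity)
      (fun i => ih _ (StrictLor_pderiv hf i)) ?_ ?_
    · intro i
      ext j
      rw [hess_mulVec (d := d + 1) (hP.1.pderiv (i := i))]
      simp only [hess, Pi.smul_apply, Matrix.of_apply, smul_eq_mul]
      rw [pderiv_comm']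
      push_cast; ring
    · intro z
      have h1 : ∀ j k, ∑ i, x i * eval x (pderiv j (pderiv k (pderiv i f)))
          = (d + 1) * eval x (pderiv j (pderiv k f)) := by
        intro j k
        have := euler_eval (d := d + 1) (f := pderiv j (pderiv k f)) hP.1.pderiv.pderiv x
        push_cast at this
        rw [← this]
        refine Finset.sum_congr rfl fun i _ => ?_
        rw [pderiv_comm' k i, pderiv_comm' j i]
      simp only [hess, Matrix.mulVec, dotProduct, Matrix.of_apply, Finset.mul_sum]
      rw [Finset.sum_comm]
      refine Finset.sum_congr rfl fun j _ => ?_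
      rw [Finset.sum_comm]
      refine Finset.sum_congr rfl fun k _ => ?_
      have h2 := h1 j k
      calc _ = z j * z k * ∑ i, x i * eval x (pderiv j (pderiv k (pderiv i f))) := by
            rw [Finset.mul_sum]; exact Finset.sum_congr rfl fun i _ => by ring
        _ = _ := by rw [h2]; ring

lemma rayleigh {n : ℕ} (hn : 0 < n) (x : Fin n → ℝ) (hx : ∀ i, 0 < x i) (d : ℕ)
    (f : MvPolynomial (Fin n) ℝ) (hf : f ∈ StrictLor n (d + 2)) (i j : Fin n) :
    (d + 2) * (eval x f * eval x (pderiv i (pderiv j f)))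
      ≤ 2 * (d + 1) * (eval x (pderiv i f) * eval x (pderiv j f)) := by
  have hP := StrictLor_PPos hf
  have h := hyp_entry hn (hess_herm f x) (hess_pos hn hP x hx) x hx (hess_hyp hn x hx d f hf) i j
  have e : x ⬝ᵥ (hess f x).mulVec x = (d + 1) * ((d + 2) * eval x f) := by
    have := euler_eval hP.1 x
    push_cast at this
    rw [← this, dotProduct, Finset.mul_sum]
    refine Finset.sum_congr rfl fun k _ => ?_
    rw [hess_mulVec (d := d + 1) hP.1]; push_cast; ring
  rw [e, hess_mulVec (d := d + 1) hP.1, hess_mulVec (d := d + 1) hP.1] at h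
  simp only [hess, Matrix.of_apply] at h
  push_cast at h
  have h0 : (0 : ℝ) < d + 1 := by positivity
  refine le_of_mul_le_mul_left ?_ h0
  nlinarith

section strict
variable {n d : ℕ}

lemma F_pos (hn : 0 < n) (x : Fin n → ℝ) (hx : ∀ i, 0 < x i)
    (f : MvPolynomial (Fin n) ℝ) (hf : f ∈ StrictLor n d) (δ : Fin n → ℕ) (hδ : ∑ k, δ k ≤ d) :
    0 < eval x (pd δ f) :=
  PPos_eval_pos hn (StrictLor_PPos (StrictLor_pd hf δ hδ)) x hx

lemma F_step (hn : 0 < n) (x : Fin n → ℝ) (hx : ∀ i, 0 < x i)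
    (f : MvPolynomial (Fin n) ℝ) (hf : f ∈ StrictLor n d) (δ : Fin n → ℕ) (m : ℕ)
    (hδ : ∑ k, δ k + m + 2 = d) (i j : Fin n) :
    (m + 2) * (eval x (pd δ f) * eval x (pd (δ + Pi.single i 1 + Pi.single j 1) f))
      ≤ 2 * (m + 1) * (eval x (pd (δ + Pi.single i 1) f) * eval x (pd (δ + Pi.single j 1) f)) := by
  have h1 := StrictLor_pd hf δ (by omega)
  rw [show d - ∑ k, δ k = m + 2 by omega] at h1
  have h2 := rayleigh hn x hx m _ h1 i j
  rw [pd_add_single, pd_add_single, pd_add_single, pderiv_comm' j i]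
  exact h2

/-- First chain; here `m + 1 + |γ| = d - |δ|`. -/
lemma F_chain1 (hn : 0 < n) (x : Fin n → ℝ) (hx : ∀ i, 0 < x i)
    (f : MvPolynomial (Fin n) ℝ) (hf : f ∈ StrictLor n d) (δ : Fin n → ℕ) (i : Fin n)
    (γ : Fin n → ℕ) (m : ℕ) (hδ : ∑ k, δ k + ∑ k, γ k + m + 1 = d) :
    ((m + 1 + ∑ k, γ k : ℕ) : ℝ) * (eval x (pd δ f) * eval x (pd (δ + γ + Pi.single i 1) f))
      ≤ 2 ^ (∑ k, γ k) * (m + 1) *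
        (eval x (pd (δ + Pi.single i 1) f) * eval x (pd (δ + γ) f)) := by
  induction γ using multi_induction generalizing m with
  | h0 => simp; exact le_of_eq (by ring)
  | hs γ j ih =>
    rw [sum_add_single] at hδ ⊢
    have h1 := ih (m + 1) (by omega)
    have hs : ∑ k, (δ + γ) k = ∑ k, δ k + ∑ k, γ k := by simp [Finset.sum_add_distrib]
    have h2 := F_step hn x hx f hf (δ + γ) m (by omega) i j
    have p1 := F_pos hn x hx f hf (δ + γ) (by omega)
    have p2 := F_pos hn x hx f hf (δ + γ + Pi.single i 1) (by rw [sum_add_single]; omega)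
    rw [show δ + (γ + Pi.single j 1) + Pi.single i 1 = δ + γ + Pi.single i 1 + Pi.single j 1 by
      abel, show δ + (γ + Pi.single j 1) = δ + γ + Pi.single j 1 by abel]
    rw [show m + 1 + (∑ k, γ k + 1) = m + 1 + 1 + ∑ k, γ k by ring]
    have p0 := F_pos hn x hx f hf δ (by omega)
    have p3 := F_pos hn x hx f hf (δ + γ + Pi.single i 1 + Pi.single j 1)
      (by rw [sum_add_single, sum_add_single]; omega)
    have p4 := F_pos hn x hx f hf (δ + Pi.single i 1) (by rw [sum_add_single]; omega)
    have hN : (0 : ℝ) ≤ ((m + 1 + 1 + ∑ k, γ k : ℕ) : ℝ) := Nat.cast_nonneg _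
    generalize ((m + 1 + 1 + ∑ k, γ k : ℕ) : ℝ) = N at *
    rw [pow_succ]
    generalize (2 : ℝ) ^ (∑ k, γ k) = T at *
    generalize eval x (pd (δ + γ) f) = a at *
    generalize eval x (pd (δ + γ + Pi.single i 1) f) = b at *
    generalize eval x (pd (δ + γ + Pi.single i 1 + Pi.single j 1) f) = e at *
    generalize eval x (pd δ f) = g at *
    generalize eval x (pd (δ + Pi.single i 1) f) = q at *
    generalize eval x (pd (δ + γ + Pi.single j 1) f) = t at *
    have h3 := mul_le_mul h1 h2 (by positivity)
      ((mul_nonneg hN (by positivity)).trans h1)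
    push_cast at h3
    have hc : 0 < ((m : ℝ) + 2) * a * b := by positivity
    refine le_of_mul_le_mul_left ?_ hc
    linarith

lemma F_chain2 (hn : 0 < n) (x : Fin n → ℝ) (hx : ∀ i, 0 < x i)
    (f : MvPolynomial (Fin n) ℝ) (hf : f ∈ StrictLor n d) (γ β : Fin n → ℕ)
    (hδ : ∑ k, β k + ∑ k, γ k ≤ d) :
    ((d.factorial * (d - (∑ k, β k + ∑ k, γ k)).factorial : ℕ) : ℝ) *
        (eval x f * eval x (pd (β + γ) f))
      ≤ 2 ^ ((∑ k, β k) * (∑ k, γ k)) *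
        (((d - ∑ k, β k).factorial * (d - ∑ k, γ k).factorial : ℕ) : ℝ) *
        (eval x (pd β f) * eval x (pd γ f)) := by
  induction β using multi_induction with
  | h0 => simp [pd_zero]
  | hs β i ih =>
    rw [sum_add_single] at hδ ⊢
    have h1 := ih (by omega)
    obtain ⟨m, hm⟩ : ∃ m, ∑ k, β k + ∑ k, γ k + m + 1 = d :=
      ⟨d - (∑ k, β k + 1 + ∑ k, γ k), by omega⟩
    have h2 := F_chain1 hn x hx f hf β i γ m hm
    have hs : ∑ k, (β + γ) k = ∑ k, β k + ∑ k, γ k := by simp [Finset.sum_add_distrib]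
    have p1 := F_pos hn x hx f hf (β + γ) (by omega)
    have p2 := F_pos hn x hx f hf β (by omega)
    have p3 := F_pos hn x hx f hf (β + γ + Pi.single i 1) (by rw [sum_add_single]; omega)
    have p4 := F_pos hn x hx f hf γ (by omega)
    rw [show d - (∑ k, β k + ∑ k, γ k) = m + 1 by omega,
      show d - ∑ k, β k = (m + ∑ k, γ k) + 1 by omega] at h1
    rw [show d - (∑ k, β k + 1 + ∑ k, γ k) = m by omega,
      show d - (∑ k, β k + 1) = m + ∑ k, γ k by omega,
      show β + Pi.single i 1 + γ = β + γ + Pi.single i 1 by abel]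
    rw [Nat.factorial_succ m, Nat.factorial_succ (m + _)] at h1
    rw [show m + 1 + ∑ k, γ k = m + ∑ k, γ k + 1 by ring] at h2
    rw [add_mul, one_mul, pow_add]
    generalize hN : m + ∑ k, γ k = N at *
    have q1 : (0 : ℝ) < N.factorial := by positivity
    have q2 : (0 : ℝ) < m.factorial := by positivity
    have q3 : (0 : ℝ) < d.factorial := by positivity
    have q4 : (0 : ℝ) < (d - ∑ k, γ k).factorial := by positivity
    push_cast at h1 h2 ⊢
    have t1 : (0 : ℝ) < 2 ^ ((∑ k, β k) * (∑ k, γ k)) := by positivity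
    have t2 : (0 : ℝ) < 2 ^ (∑ k, γ k) := by positivity
    generalize (2 : ℝ) ^ (∑ k, γ k) = T at *
    generalize (2 : ℝ) ^ ((∑ k, β k) * (∑ k, γ k)) = U at *
    generalize eval x (pd (β + γ) f) = a at *
    generalize eval x (pd (β + γ + Pi.single i 1) f) = b at *
    generalize eval x (pd (β + Pi.single i 1) f) = e at *
    generalize eval x (pd β f) = g at *
    generalize eval x (pd γ f) = q at *
    generalize eval x f = t at *
    have h3 := mul_le_mul h1 h2 (by positivity) (by positivity)
    have hc : 0 < ((m : ℝ) + 1) * a * (((N : ℝ) + 1) * g) := by positivity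
    refine le_of_mul_le_mul_left ?_ hc
    linarith

end strict

lemma pd_add {n : ℕ} (α : Fin n → ℕ) (f g : MvPolynomial (Fin n) ℝ) :
    pd α (f + g) = pd α f + pd α g := by
  induction α using multi_induction with
  | h0 => simp [pd_zero]
  | hs α i ih => simp only [pd_add_single, ih, map_add]

lemma pd_smul {n : ℕ} (α : Fin n → ℕ) (c : ℝ) (f : MvPolynomial (Fin n) ℝ) :
    pd α (c • f) = c • pd α f := by
  induction α using multi_induction with
  | h0 => simp [pd_zero]
  | hs α i ih => simp only [pd_add_single, ih, Derivation.map_smul]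

/-- The evaluation of a derivative as a linear map. -/
noncomputable def evL {n : ℕ} (α : Fin n → ℕ) (x : Fin n → ℝ) :
    MvPolynomial (Fin n) ℝ →ₗ[ℝ] ℝ where
  toFun f := eval x (pd α f)
  map_add' f g := by simp [pd_add]
  map_smul' c f := by simp [pd_smul]

/-- The evaluation of a derivative as function of the coefficients. -/
noncomputable def evC {n : ℕ} (d : ℕ) (α : Fin n → ℕ) (x : Fin n → ℝ)
    (c : (Fin n →₀ ℕ) → ℝ) : ℝ :=
  ∑ s ∈ Finset.finsuppAntidiag (Finset.univ : Finset (Fin n)) d, c s * evL α x (monomial s 1)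

lemma evC_cont {n : ℕ} (d : ℕ) (α : Fin n → ℕ) (x : Fin n → ℝ) :
    Continuous (evC d α x) := by
  unfold evC
  fun_prop

lemma evC_eq {n d : ℕ} (α : Fin n → ℕ) (x : Fin n → ℝ) {f : MvPolynomial (Fin n) ℝ}
    (hf : f.IsHomogeneous d) : evC d α x (coeffFun f) = eval x (pd α f) := by
  have h1 : f = ∑ s ∈ Finset.finsuppAntidiag (Finset.univ : Finset (Fin n)) d,
      f.coeff s • monomial s (1 : ℝ) := by
    conv_lhs => rw [f.as_sum]
    simp only [smul_monomial, smul_eq_mul, mul_one]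
    refine Finset.sum_subset (fun s hs => ?_) (fun s _ hs => ?_)
    · rw [Finset.mem_finsuppAntidiag]
      refine ⟨?_, Finset.subset_univ _⟩
      have := hf (mem_support_iff.1 hs)
      rw [← this, Finsupp.weight_apply, Finsupp.sum_fintype]
      · simp
      · simp
    · rw [notMem_support_iff.1 hs, monomial_zero]
  change _ = evL α x f
  conv_rhs => rw [h1]
  rw [map_sum]
  simp only [map_smul, smul_eq_mul]
  rfl

lemma lor_pos {n d : ℕ} (hn : 0 < n) (f : MvPolynomial (Fin n) ℝ) (hf : f ∈ Lor n d)
    (x : Fin n → ℝ) (hx : ∀ i, 0 < x i) (γ β : Fin n → ℕ)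
    (hδ : ∑ k, β k + ∑ k, γ k ≤ d) :
    ((d.factorial * (d - (∑ k, β k + ∑ k, γ k)).factorial : ℕ) : ℝ) *
        (eval x f * eval x (pd (β + γ) f))
      ≤ 2 ^ ((∑ k, β k) * (∑ k, γ k)) *
        (((d - ∑ k, β k).factorial * (d - ∑ k, γ k).factorial : ℕ) : ℝ) *
        (eval x (pd β f) * eval x (pd γ f)) := by
  let S : Set ((Fin n →₀ ℕ) → ℝ) := {c |
    ((d.factorial * (d - (∑ k, β k + ∑ k, γ k)).factorial : ℕ) : ℝ) *
        (evC d 0 x c * evC d (β + γ) x c)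
      ≤ 2 ^ ((∑ k, β k) * (∑ k, γ k)) *
        (((d - ∑ k, β k).factorial * (d - ∑ k, γ k).factorial : ℕ) : ℝ) *
        (evC d β x c * evC d γ x c)}
  have hS : IsClosed S := isClosed_le
    (continuous_const.mul ((evC_cont d 0 x).mul (evC_cont d (β + γ) x)))
    (continuous_const.mul ((evC_cont d β x).mul (evC_cont d γ x)))
  have hsub : coeffFun '' StrictLor n d ⊆ S := by
    rintro _ ⟨g, hg, rfl⟩
    have hh := (StrictLor_PPos hg).1
    simp only [S, Set.mem_ofPred_eq]
    rw [evC_eq _ _ hh, evC_eq _ _ hh, evC_eq _ _ hh, evC_eq _ _ hh, pd_zero]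
    exact F_chain2 hn x hx g hg γ β hδ
  have hmem := closure_minimal hsub hS hf.2
  simp only [S, Set.mem_ofPred_eq] at hmem
  rwa [evC_eq _ _ hf.1, evC_eq _ _ hf.1, evC_eq _ _ hf.1, evC_eq _ _ hf.1, pd_zero] at hmem

lemma lor_nonneg {n d : ℕ} (hn : 0 < n) (f : MvPolynomial (Fin n) ℝ) (hf : f ∈ Lor n d)
    (x : Fin n → ℝ) (hx : ∀ i, 0 ≤ x i) (γ β : Fin n → ℕ)
    (hδ : ∑ k, β k + ∑ k, γ k ≤ d) :
    ((d.factorial * (d - (∑ k, β k + ∑ k, γ k)).factorial : ℕ) : ℝ) *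
        (eval x f * eval x (pd (β + γ) f))
      ≤ 2 ^ ((∑ k, β k) * (∑ k, γ k)) *
        (((d - ∑ k, β k).factorial * (d - ∑ k, γ k).factorial : ℕ) : ℝ) *
        (eval x (pd β f) * eval x (pd γ f)) := by
  have hc : ∀ g : MvPolynomial (Fin n) ℝ,
      Continuous fun t : ℝ => eval (fun i => x i + t) g := fun g =>
    (MvPolynomial.continuous_eval g).comp (by fun_prop)
  have key : Set.Ioi (0 : ℝ) ⊆ {t : ℝ |
      ((d.factorial * (d - (∑ k, β k + ∑ k, γ k)).factorial : ℕ) : ℝ) *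
        (eval (fun i => x i + t) f * eval (fun i => x i + t) (pd (β + γ) f))
      ≤ 2 ^ ((∑ k, β k) * (∑ k, γ k)) *
        (((d - ∑ k, β k).factorial * (d - ∑ k, γ k).factorial : ℕ) : ℝ) *
        (eval (fun i => x i + t) (pd β f) * eval (fun i => x i + t) (pd γ f))} := by
    intro t ht
    exact lor_pos hn f hf _ (fun i => add_pos_of_nonneg_of_pos (hx i) ht) γ β hδ
  have h0 : (0 : ℝ) ∈ closure (Set.Ioi (0 : ℝ)) := by rw [closure_Ioi]; exact Set.self_mem_Ici
  have := closure_minimal key (isClosed_le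
    (continuous_const.mul ((hc _).mul (hc _))) (continuous_const.mul ((hc _).mul (hc _)))) h0
  simpa only [Set.mem_ofPred_eq, add_zero] using this

/-- rKT property for Lorentzian polynomials: for `f ∈ L_n^d`,
`x ≥ 0` and multi-indices `α = β + γ` with `|α| ≤ d`,
`f(x)·∂^α f(x) ≤ 2^{|β||γ|}·((d-|β|)!(d-|γ|)!)/(d!(d-|α|)!)·∂^β f(x)·∂^γ f(x)`. -/
theorem statement3 {n d : ℕ} (f : MvPolynomial (Fin n) ℝ) (hf : f ∈ Lor n d)
    (x : Fin n → ℝ) (hx : ∀ i, 0 ≤ x i)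
    (α β γ : Fin n → ℕ) (hbg : α = β + γ) (hα : (∑ i, α i) ≤ d) :
    eval x f * eval x (pd α f) ≤
      2 ^ ((∑ i, β i) * (∑ i, γ i)) *
        (((d - ∑ i, β i).factorial * (d - ∑ i, γ i).factorial : ℕ) : ℝ) /
        ((d.factorial * (d - ∑ i, α i).factorial : ℕ) : ℝ) *
        (eval x (pd β f) * eval x (pd γ f)) := by
  have hs : ∑ i, α i = ∑ i, β i + ∑ i, γ i := by
    rw [hbg]; simp [Finset.sum_add_distrib]
  rcases Nat.eq_zero_or_pos n with hn | hn
  · subst hn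
    have hb : β = 0 := Subsingleton.elim _ _
    have hc : γ = 0 := Subsingleton.elim _ _
    have ha : α = 0 := Subsingleton.elim _ _
    subst hb hc ha
    have h1 : ((d.factorial * d.factorial : ℕ) : ℝ) ≠ 0 := by positivity
    simp only [pd_zero, Finset.univ_eq_empty, Finset.sum_empty, mul_zero, pow_zero, Nat.sub_zero,
      one_mul]
    rw [div_self h1, one_mul]
  · have h := lor_nonneg hn f hf x hx γ β (by omega)
    rw [← hbg, ← hs] at h
    have h1 : (0 : ℝ) < ((d.factorial * (d - ∑ i, α i).factorial : ℕ) : ℝ) := by positivity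
    rw [div_mul_eq_mul_div, le_div_iff₀ h1, mul_comm]
    exact h


end LorentzianPaper
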